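/- If U' is obtained from a unit interval order U on {1,...,n} by adding an (n+1)-st element whose interval lies to the right of all others, then the area sequence p(U') is obtained from p(U) by inserting a letter ℓ (the level of the new element) such that every letter before the insertion point is at most ℓ, the letter immediately before is ℓ or ℓ−1, and every letter after is at most ℓ−1 (equivalently, the Dyck path gains a final maximal peak). -/

import Mathlib

/-- A unit interval order on `Fin n`: `x ≺ y` implies `x < y`, and
`x ≺ y` implies `x' ≺ y'` for all `x' ≤ x` and `y' ≥ y`. -/
def IsUIO {n : ℕ} (r : Fin n → Fin n → Prop) : Prop :=
  (∀ x y, r x y → x < y) ∧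
  (∀ x y, r x y → ∀ x' y', x' ≤ x → y ≤ y' → r x' y')

/-- The level function: `ℓ j = 0` if `j` is minimal, else `1 + max {ℓ i : i ≺ j}`
(for a unit interval order, `i ≺ j` implies `i < j`). -/
def level {n : ℕ} (r : Fin n → Fin n → Prop) [DecidableRel r] : Fin n → ℕ
  | j =>
    ((Finset.univ.filter (fun i => r i j ∧ i < j)).attach).sup
      (fun i => level r i.1 + 1)
termination_by j => j.val
decreasing_by
  exact (Finset.mem_filter.mp i.2).2.2

/-- `C i`: the number of elements of level `ℓ(i) − 1` comparable to `i`. -/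
def comparCount {n : ℕ} (r : Fin n → Fin n → Prop) [DecidableRel r] (i : Fin n) : ℕ :=
  (Finset.univ.filter (fun j => level r j + 1 = level r i ∧ (r j i ∨ r i j))).card

/-- Position directly after the `k`-th occurrence of `v` in a list (`0` if `k = 0`). -/
def afterKth : List ℕ → ℕ → ℕ → ℕ
  | _, _, 0 => 0
  | [], _, _ + 1 => 0
  | x :: xs, v, k + 1 =>
    if x = v then
      if k = 0 then 1 else 1 + afterKth xs v k
    else 1 + afterKth xs v (k + 1)

/-- Starting from position `p`, skip the occurrences of the letter `l`. -/
def skipRun (q : List ℕ) (l p : ℕ) : ℕ :=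
  p + ((q.drop p).takeWhile (fun x => x = l)).length

/-- The insertion algorithm: insert `ℓ(i)` directly after the occurrences of `ℓ(i)`
immediately following the `C_i`-th letter `ℓ(i) − 1`. -/
def buildQ {n : ℕ} (r : Fin n → Fin n → Prop) [DecidableRel r] : ℕ → List ℕ
  | 0 => []
  | i + 1 =>
    let q := buildQ r i
    if h : i < n then
      let l := level r ⟨i, h⟩
      q.insertIdx (skipRun q l (afterKth q (l - 1) (comparCount r ⟨i, h⟩))) l
    else q

/-- The part listing `q(U)` produced by the insertion algorithm. -/
def qList {n : ℕ} (r : Fin n → Fin n → Prop) [DecidableRel r] : List ℕ :=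
  buildQ r n

lemma level_eq {n : ℕ} (r : Fin n → Fin n → Prop) [DecidableRel r] (j : Fin n) :
    level r j = (Finset.univ.filter (fun i => r i j ∧ i < j)).sup (fun i => level r i + 1) := by
  rw [level]
  exact Finset.sup_attach _ (fun i => level r i + 1)

lemma level_lt {n : ℕ} {r : Fin n → Fin n → Prop} [DecidableRel r] (h : IsUIO r)
    {i j : Fin n} (hij : r i j) : level r i < level r j := by
  rw [level_eq r j]
  have := Finset.le_sup (s := Finset.univ.filter (fun i => r i j ∧ i < j))
    (f := fun i => level r i + 1) (b := i) (by simp [hij, h.1 _ _ hij])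
  exact this

lemma level_mono {n : ℕ} {r : Fin n → Fin n → Prop} [DecidableRel r] (h : IsUIO r)
    {i j : Fin n} (hij : i ≤ j) : level r i ≤ level r j := by
  rw [level_eq r i]
  apply Finset.sup_le
  intro p hp
  simp only [Finset.mem_filter, Finset.mem_univ, true_and] at hp
  exact level_lt h (h.2 _ _ hp.1 _ _ le_rfl hij)

lemma level_pred {n : ℕ} {r : Fin n → Fin n → Prop} [DecidableRel r]
    {j : Fin n} (hj : 1 ≤ level r j) : ∃ i, r i j ∧ level r i + 1 = level r j := by
  have hne : (Finset.univ.filter (fun i => r i j ∧ i < j)).Nonempty := by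
    rw [Finset.nonempty_iff_ne_empty]
    intro he
    rw [level_eq, he] at hj
    simp at hj
  obtain ⟨i, hi, he⟩ := Finset.exists_mem_eq_sup _ hne (fun i => level r i + 1)
  rw [← level_eq] at he
  simp only [Finset.mem_filter, Finset.mem_univ, true_and] at hi
  exact ⟨i, hi.1, he.symm⟩

lemma comparCount_pos {n : ℕ} {r : Fin n → Fin n → Prop} [DecidableRel r]
    {j : Fin n} (hj : 1 ≤ level r j) : 1 ≤ comparCount r j := by
  obtain ⟨i, hi, he⟩ := level_pred hj
  exact Finset.card_pos.2 ⟨i, by simp [hi, he]⟩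

lemma comparCount_zero {n : ℕ} {r : Fin n → Fin n → Prop} [DecidableRel r]
    {j : Fin n} (hj : level r j = 0) : comparCount r j = 0 := by
  simp [comparCount, hj]

lemma comparCount_mono {n : ℕ} {r : Fin n → Fin n → Prop} [DecidableRel r] (h : IsUIO r)
    {i j : Fin n} (hij : i ≤ j) (he : level r i = level r j) :
    comparCount r i ≤ comparCount r j := by
  apply Finset.card_le_card
  intro p hp
  simp only [Finset.mem_filter, Finset.mem_univ, true_and] at hp ⊢
  refine ⟨by omega, ?_⟩
  rcases hp.2 with h1 | h1
  · exact Or.inl (h.2 _ _ h1 _ _ le_rfl hij)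
  · have := level_lt h h1
    omega

lemma comparCount_le {n : ℕ} {r : Fin n → Fin n → Prop} [DecidableRel r] (h : IsUIO r)
    (j : Fin n) : comparCount r j ≤
      (Finset.univ.filter (fun i : Fin n => i.val < j.val ∧ level r i = level r j - 1)).card := by
  apply Finset.card_le_card
  intro p hp
  simp only [Finset.mem_filter, Finset.mem_univ, true_and] at hp ⊢
  refine ⟨?_, by omega⟩
  by_contra hlt
  have := level_mono h (i := j) (j := p) (by simpa using hlt)
  omega

lemma afterKth_append (A B : List ℕ) (v : ℕ) :
    afterKth (A ++ v :: B) v (A.count v + 1) = A.length + 1 := by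
  induction A with
  | nil => simp [afterKth]
  | cons x xs ih =>
    by_cases hx : x = v
    · subst hx
      simp [afterKth, ih]; omega
    · simp [afterKth, hx, List.count_cons_of_ne hx, ih]; omega

lemma split_count (v : ℕ) (l : List ℕ) : ∀ k, 1 ≤ k → k ≤ l.count v →
    ∃ A B, l = A ++ v :: B ∧ A.count v + 1 = k := by
  induction l with
  | nil => intro k h1 h2; simp at h2; omega
  | cons x xs ih =>
    intro k h1 h2
    by_cases hx : x = v
    · subst hx
      by_cases hk : k = 1
      · exact ⟨[], xs, by simp, by simp [hk]⟩
      · simp at h2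
        obtain ⟨A, B, e, hc⟩ := ih (k - 1) (by omega) (by omega)
        exact ⟨x :: A, B, by simp [e], by simp; omega⟩
    · rw [List.count_cons_of_ne hx] at h2
      obtain ⟨A, B, e, hc⟩ := ih k h1 h2
      exact ⟨x :: A, B, by simp [e], by rw [List.count_cons_of_ne hx]; exact hc⟩

lemma takeWhile_rep (m t : ℕ) (B : List ℕ) (hB : ∀ x ∈ B, x < m) :
    ((List.replicate t m ++ B).takeWhile (fun x => x = m)).length = t := by
  induction t with
  | zero =>
    cases B with
    | nil => simp
    | cons b bs =>
      have : b ≠ m := by have := hB b (by simp); omega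
      simp [this]
  | succ t ih => simpa [List.replicate_succ] using ih

/-- Canonical shape: all `m` lie before or right after the `c`-th `m - 1`. -/
def Good (q : List ℕ) (m c : ℕ) : Prop :=
  ∃ A t B, q = A ++ (m - 1) :: (List.replicate t m ++ B) ∧ (∀ x ∈ A, x ≤ m) ∧
    (∀ x ∈ B, x < m) ∧ A.count (m - 1) + 1 = c

lemma good_of_lt {q : List ℕ} {m C : ℕ} (hq : ∀ x ∈ q, x < m)
    (h1 : 1 ≤ C) (h2 : C ≤ q.count (m - 1)) : Good q m C := by
  obtain ⟨A, B, e, hc⟩ := split_count _ _ C h1 h2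
  subst e
  exact ⟨A, 0, B, by simp, fun x hx => (hq x (by simp [hx])).le,
    fun x hx => hq x (by simp [hx]), hc⟩

lemma good_mono {q : List ℕ} {m c C : ℕ} (hm : 1 ≤ m) (hg : Good q m c)
    (h1 : c ≤ C) (h2 : C ≤ q.count (m - 1)) : Good q m C := by
  obtain ⟨A, t, B, e, hA, hB, hc⟩ := hg
  by_cases hcC : c = C
  · exact ⟨A, t, B, e, hA, hB, hcC ▸ hc⟩
  have hne : m ≠ m - 1 := by omega
  have hr : (List.replicate t m).count (m - 1) = 0 := by
    simp [List.count_replicate, hne]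
  subst e
  simp [hr] at h2
  obtain ⟨B1, B2, e, hc'⟩ := split_count (m - 1) B (C - c) (by omega) (by omega)
  subst e
  refine ⟨A ++ (m - 1) :: (List.replicate t m ++ B1), 0, B2, by simp, ?_, ?_, ?_⟩
  · intro x hx
    simp only [List.mem_append, List.mem_cons, List.mem_replicate] at hx
    rcases hx with hx | hx | hx | hx
    · exact hA x hx
    · omega
    · omega
    · exact (hB x (by simp [hx])).le
  · intro x hx
    exact hB x (by simp [hx])
  · simp [hr]; omega

/-- Result of an insertion step. -/
lemma good_pos {m c : ℕ} {A B : List ℕ} {t : ℕ} 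
    (hB : ∀ x ∈ B, x < m) (hc : A.count (m - 1) + 1 = c) :
    skipRun (A ++ (m - 1) :: (List.replicate t m ++ B)) m
      (afterKth (A ++ (m - 1) :: (List.replicate t m ++ B)) (m - 1) c) = A.length + 1 + t := by
  rw [← hc, afterKth_append, skipRun]
  have : (A ++ (m - 1) :: (List.replicate t m ++ B)).drop (A.length + 1)
      = List.replicate t m ++ B := by
    rw [List.drop_append]; simp
  rw [this, takeWhile_rep m t B hB]

lemma good_insert (m : ℕ) (A B : List ℕ) (t : ℕ) :
    (A ++ (m - 1) :: (List.replicate t m ++ B)).insertIdx (A.length + 1 + t) m =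
      A ++ (m - 1) :: (List.replicate (t + 1) m ++ B) := by
  have e1 : A ++ (m - 1) :: (List.replicate t m ++ B)
      = (A ++ (m - 1) :: List.replicate t m) ++ B := by simp
  have e2 : A.length + 1 + t = (A ++ (m - 1) :: List.replicate t m).length := by
    simp; omega
  have key : ∀ X Y : List ℕ, (X ++ Y).insertIdx X.length m = X ++ m :: Y := by
    intro X Y
    induction X with
    | nil => simp
    | cons x xs ih => simpa using ih
  rw [e1, e2, key]
  simp [List.replicate_succ']

lemma skipRun_zero {q : List ℕ} (hq : ∀ x ∈ q, x = 0) : skipRun q 0 0 = q.length := by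
  have : q.takeWhile (fun x => x = 0) = q := by
    rw [List.takeWhile_eq_self_iff]; simpa using hq
  simp [skipRun, this]

/-- The position used in step `i`. -/
lemma pos_le {q : List ℕ} {l C : ℕ} (h0 : l = 0 → C = 0 ∧ ∀ x ∈ q, x = 0)
    (h1 : 1 ≤ l → Good q l C) : skipRun q l (afterKth q (l - 1) C) ≤ q.length := by
  rcases Nat.eq_zero_or_pos l with hl | hl
  · obtain ⟨rfl, hq⟩ := h0 hl
    subst hl
    have : afterKth q (0 - 1) 0 = 0 := by cases q <;> rfl
    rw [this, skipRun_zero hq]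
  · obtain ⟨A, t, B, e, hA, hB, hc⟩ := h1 hl
    subst e
    rw [good_pos hB hc]
    simp; omega

lemma step_shape {n : ℕ} {r : Fin n → Fin n → Prop} [DecidableRel r] (h : IsUIO r)
    (q : List ℕ) (j : Fin n)
    (hcount : ∀ v, q.count v =
      (Finset.univ.filter (fun a : Fin n => a.val < j.val ∧ level r a = v)).card)
    (hprev : ∀ a : Fin n, a.val + 1 = j.val → 1 ≤ level r a →
      Good q (level r a) (comparCount r a)) :
    (level r j = 0 → comparCount r j = 0 ∧ ∀ x ∈ q, x = 0) ∧
    (1 ≤ level r j → Good q (level r j) (comparCount r j)) := by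
  have hmem : ∀ x ∈ q, ∃ a : Fin n, a.val < j.val ∧ level r a = x := by
    intro x hx
    have := List.count_pos_iff.2 hx
    rw [hcount, Finset.card_pos] at this
    obtain ⟨a, ha⟩ := this
    exact ⟨a, by simpa using ha⟩
  constructor
  · intro h0
    refine ⟨comparCount_zero h0, fun x hx => ?_⟩
    obtain ⟨a, ha, rfl⟩ := hmem x hx
    have := level_mono h (i := a) (j := j) (Fin.le_def.2 ha.le)
    omega
  · intro h1
    have hC1 := comparCount_pos h1
    have hC2 : comparCount r j ≤ q.count (level r j - 1) := by
      rw [hcount]; exact comparCount_le h j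
    by_cases hlt : ∀ x ∈ q, x < level r j
    · exact good_of_lt hlt hC1 hC2
    · push Not at hlt
      obtain ⟨x, hx, hxl⟩ := hlt
      obtain ⟨a, ha, rfl⟩ := hmem x hx
      have hjn := j.2
      let b : Fin n := ⟨j.val - 1, by omega⟩
      have hab : a ≤ b := Fin.le_def.2 (by simp [b]; omega)
      have hbj : b ≤ j := Fin.le_def.2 (by simp [b])
      have h2 := level_mono h hab
      have h3 := level_mono h hbj
      have hb : level r b = level r j := by omega
      have hg := hprev b (by simp [b]; omega) (by omega)
      rw [hb] at hg
      exact good_mono h1 hg (comparCount_mono h hbj hb) hC2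

lemma buildQ_succ {n : ℕ} (r : Fin n → Fin n → Prop) [DecidableRel r] (j : Fin n) :
    buildQ r (j.val + 1) = (buildQ r j.val).insertIdx
      (skipRun (buildQ r j.val) (level r j)
        (afterKth (buildQ r j.val) (level r j - 1) (comparCount r j))) (level r j) := by
  simp [buildQ]

lemma buildQ_inv {n : ℕ} {r : Fin n → Fin n → Prop} [DecidableRel r] (h : IsUIO r) :
    ∀ i ≤ n, (buildQ r i).length = i ∧
      (∀ v, (buildQ r i).count v =
        (Finset.univ.filter (fun a : Fin n => a.val < i ∧ level r a = v)).card) ∧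
      (∀ a : Fin n, a.val + 1 = i → 1 ≤ level r a →
        Good (buildQ r i) (level r a) (comparCount r a)) := by
  intro i
  induction i with
  | zero => intro _; simp [buildQ]
  | succ i ih =>
    intro hi
    obtain ⟨hlen, hcount, hprev⟩ := ih (by omega)
    let j : Fin n := ⟨i, by omega⟩
    have hb := buildQ_succ r j
    obtain ⟨h0, h1⟩ := step_shape h (buildQ r i) j hcount hprev
    have hp := pos_le h0 h1
    change buildQ r (i + 1) = (buildQ r i).insertIdx _ _ at hb
    refine ⟨?_, ?_, ?_⟩
    · rw [hb, List.length_insertIdx_of_le_length hp, hlen]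
    · intro v
      rw [hb, (List.perm_insertIdx _ _ hp).count_eq, List.count_cons, hcount]
      by_cases hv : level r j = v
      · have : (Finset.univ.filter (fun a : Fin n => a.val < i + 1 ∧ level r a = v))
            = insert j (Finset.univ.filter (fun a : Fin n => a.val < i ∧ level r a = v)) := by
          ext a
          simp only [Finset.mem_filter, Finset.mem_univ, true_and, Finset.mem_insert]
          constructor
          · rintro ⟨ha, hl⟩
            by_cases hai : a.val = i
            · exact Or.inl (Fin.ext hai)
            · exact Or.inr ⟨by omega, hl⟩
          · rintro (rfl | ⟨ha, hl⟩)
            · exact ⟨by simp [j], hv⟩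
            · exact ⟨by omega, hl⟩
        rw [this, Finset.card_insert_of_notMem (by simp [j])]
        simp [hv]
      · have : (Finset.univ.filter (fun a : Fin n => a.val < i + 1 ∧ level r a = v))
            = (Finset.univ.filter (fun a : Fin n => a.val < i ∧ level r a = v)) := by
          ext a
          simp only [Finset.mem_filter, Finset.mem_univ, true_and]
          constructor
          · rintro ⟨ha, hl⟩
            by_cases hai : a.val = i
            · exact absurd ((congrArg (level r) (Fin.ext hai : a = j)).symm.trans hl) hv
            · exact ⟨by omega, hl⟩
          · rintro ⟨ha, hl⟩
            exact ⟨by omega, hl⟩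
        rw [this]
        simp [hv]
    · intro a ha hla
      have haj : a = j := Fin.ext (by simp [j]; omega)
      subst haj
      obtain ⟨A, t, B, e, hA, hB, hc⟩ := h1 hla
      refine ⟨A, t + 1, B, ?_, hA, hB, hc⟩
      rw [hb, e, good_pos hB hc, good_insert]

lemma level_castSucc {n : ℕ} {r : Fin n → Fin n → Prop}
    {r' : Fin (n + 1) → Fin (n + 1) → Prop} [DecidableRel r] [DecidableRel r']
    (hres : ∀ i j : Fin n, r' i.castSucc j.castSucc ↔ r i j) (k : ℕ) :
    ∀ j : Fin n, j.val = k → level r' j.castSucc = level r j := by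
  induction k using Nat.strong_induction_on with
  | _ k ih =>
    intro j hj
    rw [level_eq r', level_eq r]
    apply le_antisymm
    · apply Finset.sup_le
      intro p hp
      simp only [Finset.mem_filter, Finset.mem_univ, true_and] at hp
      have hlt : p.val < j.val := hp.2
      have hpn : p.val < n := by have := j.2; omega
      obtain ⟨p0, rfl⟩ : ∃ p0 : Fin n, p = p0.castSucc := ⟨⟨p.val, hpn⟩, rfl⟩
      rw [ih p0.val (by simpa [← hj] using hlt) p0 rfl]
      exact Finset.le_sup (f := fun i => level r i + 1)
        (by simpa [← hres] using hp)
    · apply Finset.sup_le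
      intro p hp
      simp only [Finset.mem_filter, Finset.mem_univ, true_and] at hp
      rw [← ih p.val (by simpa [← hj] using hp.2) p rfl]
      exact Finset.le_sup (f := fun i => level r' i + 1)
        (by simpa [hres] using hp)

lemma comparCount_castSucc {n : ℕ} {r : Fin n → Fin n → Prop}
    {r' : Fin (n + 1) → Fin (n + 1) → Prop} [DecidableRel r] [DecidableRel r']
    (h' : IsUIO r')
    (hres : ∀ i j : Fin n, r' i.castSucc j.castSucc ↔ r i j) (j : Fin n) :
    comparCount r' j.castSucc = comparCount r j := by
  unfold comparCount
  symm
  apply Finset.card_bij (fun a _ => a.castSucc)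
  · intro a ha
    simpa [hres, level_castSucc hres _ _ rfl] using ha
  · intro a _ b _ hab
    exact Fin.castSucc_injective _ hab
  · intro b hb
    simp only [Finset.mem_filter, Finset.mem_univ, true_and] at hb
    have hbn : b.val < n := by
      by_contra hge
      have := level_mono h' (i := j.castSucc) (j := b)
        (Fin.le_def.2 (by have := j.2; simp; omega))
      omega
    obtain ⟨b0, rfl⟩ : ∃ b0 : Fin n, b = b0.castSucc := ⟨⟨b.val, hbn⟩, rfl⟩
    exact ⟨b0, by simpa [hres, level_castSucc hres _ _ rfl] using hb, rfl⟩

lemma buildQ_castSucc {n : ℕ} {r : Fin n → Fin n → Prop}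
    {r' : Fin (n + 1) → Fin (n + 1) → Prop} [DecidableRel r] [DecidableRel r']
    (h' : IsUIO r')
    (hres : ∀ i j : Fin n, r' i.castSucc j.castSucc ↔ r i j) :
    ∀ i ≤ n, buildQ r' i = buildQ r i := by
  intro i
  induction i with
  | zero => intro _; rfl
  | succ i ih =>
    intro hi
    have e1 := buildQ_succ r ⟨i, by omega⟩
    have e2 := buildQ_succ r' (Fin.castSucc ⟨i, by omega⟩)
    rw [level_castSucc hres _ _ rfl, comparCount_castSucc h' hres] at e2
    simp only [Fin.val_castSucc] at e1 e2
    rw [e1, e2, ih (by omega)]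

/-- If `U'` is obtained from a unit interval order `U` on
`{1,…,n}` by adding an `(n+1)`-st rightmost interval of level `ℓ`, then the
area sequence `p(U')` is obtained from `p(U)` by inserting a letter `ℓ` such
that every letter before the insertion point is at most `ℓ`, the letter
immediately before is `ℓ` or `ℓ − 1`, and every letter after is at most
`ℓ − 1` (the Dyck path gains a final maximal peak). -/
theorem qList_extend {n : ℕ} (r : Fin n → Fin n → Prop)
    (r' : Fin (n + 1) → Fin (n + 1) → Prop)
    [DecidableRel r] [DecidableRel r']
    (h : IsUIO r) (h' : IsUIO r')
    (hres : ∀ i j : Fin n, r' i.castSucc j.castSucc ↔ r i j) :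
    ∃ k ≤ n,
      qList r' = (qList r).insertIdx k (level r' (Fin.last n)) ∧
      (∀ j < k, (qList r).getD j 0 ≤ level r' (Fin.last n)) ∧
      (0 < k → (qList r).getD (k - 1) 0 = level r' (Fin.last n) ∨
        (qList r).getD (k - 1) 0 + 1 = level r' (Fin.last n)) ∧
      (∀ j : ℕ, k ≤ j → j < n → (qList r).getD j 0 < level r' (Fin.last n)) := by
  have hq : buildQ r' n = qList r := buildQ_castSucc h' hres n le_rfl
  obtain ⟨hlen, hcount, hprev⟩ := buildQ_inv h' n (by omega)
  have hs := step_shape h' (buildQ r' n) (Fin.last n) (by simpa using hcount)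
    (by simpa using hprev)
  have hb := buildQ_succ r' (Fin.last n)
  simp only [Fin.val_last] at hb
  have hle := pos_le hs.1 hs.2
  rw [hq] at hs hb hlen hle
  obtain ⟨h0, h1⟩ := hs
  refine ⟨_, hle.trans hlen.le, hb, ?_⟩
  generalize level r' (Fin.last n) = m at *
  generalize comparCount r' (Fin.last n) = C at *
  generalize qList r = q at *
  rcases Nat.eq_zero_or_pos m with hm | hm
  · obtain ⟨rfl, hz⟩ := h0 hm
    subst hm
    have e : afterKth q (0 - 1) 0 = 0 := by cases q <;> rfl
    rw [e, skipRun_zero hz, hlen]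
    have hz' : ∀ j, q.getD j 0 = 0 := by
      intro j
      by_cases hj : j < q.length
      · rw [List.getD_eq_getElem _ _ hj]; exact hz _ (List.getElem_mem hj)
      · exact List.getD_eq_default _ _ (by omega)
    exact ⟨fun j _ => (hz' j).le, fun _ => Or.inl (hz' _), fun j _ _ => by omega⟩
  · obtain ⟨A, t, B, e, hA, hB, hc⟩ := h1 hm
    subst e
    rw [good_pos hB hc]
    have hlen' : A.length + (t + B.length + 1) = n := by simpa using hlen
    have e1 : A ++ (m - 1) :: (List.replicate t m ++ B)
      = (A ++ (m - 1) :: List.replicate t m) ++ B := by simp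
    refine ⟨fun j hj => ?_, fun _ => ?_, fun j hj hjn => ?_⟩
    · rw [e1, List.getD_append _ _ _ _ (by simp; omega),
        List.getD_eq_getElem _ _ (by simp; omega)]
      have := List.getElem_mem (l := A ++ (m - 1) :: List.replicate t m) (n := j)
        (by simp; omega)
      simp only [List.mem_append, List.mem_cons, List.mem_replicate] at this
      rcases this with hx | hx | hx
      · exact hA _ hx
      · omega
      · omega
    · rw [List.getD_append_right _ _ _ _ (by omega)]
      rcases Nat.eq_zero_or_pos t with ht | ht
      · right
        subst ht
        simp; omega
      · left
        obtain ⟨s, rfl⟩ : ∃ s, t = s + 1 := ⟨t - 1, by omega⟩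
        have : A.length + 1 + (s + 1) - 1 - A.length = s + 1 := by omega
        rw [this, List.getD_cons_succ, List.getD_append _ _ _ _ (by simp),
          List.getD_eq_getElem _ _ (by simp)]
        simp
    · rw [e1, List.getD_append_right _ _ _ _ (by simp; omega),
        List.getD_eq_getElem _ _ (by simp; omega)]
      exact hB _ (List.getElem_mem _)
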